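/- In the group G = F ⋊_φ ℤ/4 of Example 6.2, the subgroup L₁ (the image in G of the subgroup of F generated by x₀, x₁ and x₂) has height 3 in G: (a) there exist three elements g₁, g₂, g₃ of G lying in pairwise distinct cosets of L₁ such that the intersection g₁⁻¹L₁g₁ ∩ g₂⁻¹L₁g₂ ∩ g₃⁻¹L₁g₃ is infinite; and (b) for any four elements g₁, g₂, g₃, g₄ of G lying in pairwise distinct cosets of L₁, the intersection ⋂_{i=1}^{4} gᵢ⁻¹L₁gᵢ is finite. -/

import Mathlib

noncomputable section

/-- The free group on basis `{x_i : i ∈ ℤ/4}`. -/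
abbrev F : Type := FreeGroup (ZMod 4)

/-- The action of `ℤ/4` on `F` permuting the basis by `x_i ↦ x_{i+k}`. -/
def φ : Multiplicative (ZMod 4) →* MulAut F where
  toFun k := (FreeGroup.freeGroupCongr (Equiv.addRight (Multiplicative.toAdd k)) : F ≃* F)
  map_one' := by
    ext x
    simp
  map_mul' a b := by
    have h : (fun i : ZMod 4 => i + Multiplicative.toAdd (a * b)) =
        ((fun i : ZMod 4 => i + Multiplicative.toAdd a) ∘
          fun i : ZMod 4 => i + Multiplicative.toAdd b) := by
      funext i
      show i + (Multiplicative.toAdd a + Multiplicative.toAdd b) =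
        i + Multiplicative.toAdd b + Multiplicative.toAdd a
      abel
    ext x
    rw [MulAut.mul_apply]
    show FreeGroup.map _ x = FreeGroup.map _ (FreeGroup.map _ x)
    rw [FreeGroup.map.comp]
    exact congrArg (fun f => FreeGroup.map f x) h

/-- The group `G = F ⋊ ℤ/4` of Examples 6.1 and 6.2. -/
abbrev G : Type := F ⋊[φ] Multiplicative (ZMod 4)

/-- The conjugate subgroup `g⁻¹ H g = {g⁻¹ h g : h ∈ H}`. -/
def conjSub {G : Type*} [Group G] (g : G) (H : Subgroup G) : Subgroup G :=
  H.map (MulAut.conj g⁻¹).toMonoidHom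

/-- `a` lies in the double coset `H b H`. -/
def inDoubleCoset {G : Type*} [Group G] (H : Subgroup G) (a b : G) : Prop :=
  ∃ h₁ ∈ H, ∃ h₂ ∈ H, a = h₁ * b * h₂

/-- The subgroup `L₁ = ⟨x₀, x₁, x₂⟩` of Example 6.2, viewed inside `G`. -/
def L₁ : Subgroup G :=
  Subgroup.map (SemidirectProduct.inl : F →* G)
    (Subgroup.closure {FreeGroup.of (0 : ZMod 4), FreeGroup.of 1, FreeGroup.of 2})

/-- A commutative free group is cyclic. -/
theorem FreeGroup.exists_forall_mem_zpowers_of_comm {α : Type*}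
    (hcomm : ∀ x y : FreeGroup α, x * y = y * x) :
    ∃ c : FreeGroup α, ∀ x, x ∈ Subgroup.zpowers c := by
  classical
  have hα : ∀ a b : α, a = b := by
    intro a b
    by_contra hab
    let f : FreeGroup α →* Equiv.Perm (Fin 3) :=
      FreeGroup.lift fun i => if i = a then Equiv.swap 0 1 else Equiv.swap 1 2
    have h := congrArg f (hcomm (FreeGroup.of a) (FreeGroup.of b))
    simp only [_root_.map_mul, f, FreeGroup.lift_apply_of, if_true, if_neg (Ne.symm hab)] at h
    revert h
    decide
  rcases isEmpty_or_nonempty α with hE | ⟨⟨a⟩⟩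
  · exact ⟨1, fun x => by rw [Subsingleton.elim x 1]; exact Subgroup.one_mem _⟩
  · refine ⟨FreeGroup.of a, fun x => ?_⟩
    induction x using FreeGroup.induction_on with
    | C1 => exact Subgroup.one_mem _
    | of b => rw [hα b a]; exact Subgroup.mem_zpowers _
    | inv_of b hb => exact Subgroup.inv_mem _ hb
    | mul x y hx hy => exact Subgroup.mul_mem _ hx hy

/-- Commuting elements of a free group are powers of a common element. -/
theorem FreeGroup.exists_zpow_eq_of_commute {α : Type*} {u v : FreeGroup α}
    (h : u * v = v * u) : ∃ (c : FreeGroup α) (m n : ℤ), c ^ m = u ∧ c ^ n = v := by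
  let K : Subgroup (FreeGroup α) := Subgroup.closure {u, v}
  have hcomm : IsMulCommutative K := Subgroup.isMulCommutative_closure (k := {u, v}) (by
    rintro x (rfl | rfl) y (rfl | rfl) <;> simp [h])
  have hK : ∀ x y : K, x * y = y * x := hcomm.is_comm.comm
  obtain ⟨c, hc⟩ := FreeGroup.exists_forall_mem_zpowers_of_comm
    (α := IsFreeGroup.Generators K) (fun x y => (IsFreeGroup.mulEquiv K).injective (by
      rw [_root_.map_mul, _root_.map_mul]; exact hK _ _))
  have key : ∀ x ∈ K, ∃ n : ℤ, ((IsFreeGroup.mulEquiv K c : K) : FreeGroup α) ^ n = x := by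
    intro x hx
    obtain ⟨n, hn⟩ := hc ((IsFreeGroup.mulEquiv K).symm ⟨x, hx⟩)
    refine ⟨n, ?_⟩
    have h2 := congrArg (IsFreeGroup.mulEquiv K) hn
    simp only [_root_.map_zpow, MulEquiv.apply_symm_apply] at h2
    simpa using congrArg Subtype.val h2
  obtain ⟨m, hm⟩ := key u (Subgroup.subset_closure (by simp))
  obtain ⟨n, hn⟩ := key v (Subgroup.subset_closure (by simp))
  exact ⟨_, m, n, hm, hn⟩

/-- If `ρ` is an endomorphism of a free group, the subgroup of its fixed points is malnormal as
soon as `ρ` is idempotent. -/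
theorem FreeGroup.fixed_of_conj_fixed {α : Type*} (ρ : FreeGroup α →* FreeGroup α)
    (hρ : ∀ x, ρ (ρ x) = ρ x) {u h : FreeGroup α} (h1 : h ≠ 1) (hh : ρ h = h)
    (hu : ρ (u * h * u⁻¹) = u * h * u⁻¹) : ρ u = u := by
  have hcomm : (ρ u)⁻¹ * u * h = h * ((ρ u)⁻¹ * u) := by
    simp only [_root_.map_mul, _root_.map_inv, hh] at hu
    have h2 : u * h = ρ u * h * (ρ u)⁻¹ * u := by rw [hu]; group
    rw [mul_assoc, h2]; group
  obtain ⟨c, m, n, hm, hn⟩ := FreeGroup.exists_zpow_eq_of_commute hcomm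
  have h3 : ρ c ^ m = 1 := by rw [← _root_.map_zpow, hm]; simp [hρ]
  rcases IsMulTorsionFree.zpow_eq_one_iff.mp h3 with h4 | h4
  · exact absurd (by rw [← hh, ← hn, _root_.map_zpow, h4, one_zpow]) h1
  · rw [h4, zpow_zero] at hm
    exact inv_mul_eq_one.mp hm.symm

/-- The endomorphism of `F` killing `x_j` and fixing the other generators. -/
def kill (j : ZMod 4) : F →* F :=
  FreeGroup.lift fun i => if i = j then 1 else FreeGroup.of i

theorem kill_of (j i : ZMod 4) :
    kill j (FreeGroup.of i) = if i = j then 1 else FreeGroup.of i :=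
  FreeGroup.lift_apply_of

theorem kill_kill (j : ZMod 4) (x : F) : kill j (kill j x) = kill j x := by
  have : (kill j).comp (kill j) = kill j := by
    ext i
    simp only [MonoidHom.comp_apply, kill_of]
    split_ifs with h <;> simp [kill_of, h]
  exact DFunLike.congr_fun this x

theorem kill_kill_kill_kill (x : F) : kill 0 (kill 1 (kill 2 (kill 3 x))) = 1 := by
  have : (kill 0).comp ((kill 1).comp ((kill 2).comp (kill 3))) = 1 := by
    ext i
    fin_cases i <;> simp <;> decide
  exact DFunLike.congr_fun this x

theorem φ_of (k i : ZMod 4) :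
    φ (Multiplicative.ofAdd k) (FreeGroup.of i) = FreeGroup.of (i + k) := by
  simp [φ]

theorem kill_φ (j : ZMod 4) (k : Multiplicative (ZMod 4)) (x : F) :
    kill j (φ k x) = φ k (kill (j - k.toAdd) x) := by
  have : (kill j).comp (φ k).toMonoidHom = (φ k).toMonoidHom.comp (kill (j - k.toAdd)) := by
    ext i
    have h := φ_of k.toAdd i
    rw [ofAdd_toAdd] at h
    simp only [MonoidHom.comp_apply, MulEquiv.coe_toMonoidHom, kill_of, h, eq_sub_iff_add_eq]
    split_ifs <;> simp [h]
  exact DFunLike.congr_fun this x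

/-- The free factor `⟨x₀, x₁, x₂⟩` is the fixed subgroup of the retraction killing `x₃`. -/
theorem mem_closure_iff_kill (x : F) :
    x ∈ Subgroup.closure {FreeGroup.of (0 : ZMod 4), FreeGroup.of 1, FreeGroup.of 2} ↔
      kill 3 x = x := by
  constructor
  · intro hx
    induction hx using Subgroup.closure_induction with
    | mem x hx => rcases hx with rfl | rfl | rfl <;> rw [kill_of, if_neg (by decide)]
    | one => simp
    | mul x y _ _ hx hy => simp [hx, hy]
    | inv x _ hx => simp [hx]
  · intro hx
    rw [← hx]
    clear hx
    induction x using FreeGroup.induction_on with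
    | C1 => simp
    | of b =>
      rw [kill_of]
      split_ifs with h
      · exact Subgroup.one_mem _
      · refine Subgroup.subset_closure ?_
        have : b = 0 ∨ b = 1 ∨ b = 2 := by revert b; decide
        rcases this with rfl | rfl | rfl <;> simp
    | inv_of b hb => rw [map_inv]; exact Subgroup.inv_mem _ hb
    | mul x y hx hy => rw [map_mul]; exact Subgroup.mul_mem _ hx hy

theorem mem_L₁_iff (g : G) : g ∈ L₁ ↔ g.right = 1 ∧ kill 3 g.left = g.left := by
  rw [L₁, Subgroup.mem_map]
  constructor
  · rintro ⟨x, hx, rfl⟩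
    exact ⟨rfl, (mem_closure_iff_kill x).mp hx⟩
  · rintro ⟨h1, h2⟩
    exact ⟨g.left, (mem_closure_iff_kill _).mpr h2, SemidirectProduct.ext rfl h1.symm⟩

theorem mem_conjSub_iff {H : Type*} [Group H] (g y : H) (K : Subgroup H) :
    y ∈ conjSub g K ↔ g * y * g⁻¹ ∈ K := by
  rw [conjSub, Subgroup.mem_map]
  constructor
  · rintro ⟨x, hx, rfl⟩
    simpa [mul_assoc] using hx
  · intro h
    exact ⟨_, h, by simp [mul_assoc]⟩

/-- Membership in a conjugate of `L₁`, in coordinates. -/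
theorem mem_conjSub_L₁_iff (g y : G) :
    y ∈ conjSub g L₁ ↔ y.right = 1 ∧
      kill 3 (g.left * φ g.right y.left * g.left⁻¹) = g.left * φ g.right y.left * g.left⁻¹ := by
  rw [mem_conjSub_iff, mem_L₁_iff]
  have hr : (g * y * g⁻¹).right = y.right := by
    rw [SemidirectProduct.mul_right, SemidirectProduct.mul_right, SemidirectProduct.inv_right,
      mul_comm g.right, mul_inv_cancel_right]
  rw [hr]
  refine and_congr_right fun h => ?_
  have hl : (g * y * g⁻¹).left = g.left * φ g.right y.left * g.left⁻¹ := by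
    simp [h]
  rw [hl]

/-- An element of `F` lying in a conjugate of `L₁` is conjugate in `F` to its image under the
retraction killing the missing generator. -/
theorem isConj_kill_of_mem {g y : G} (hy : y ∈ conjSub g L₁) :
    IsConj y.left (kill (3 - g.right.toAdd) y.left) := by
  obtain ⟨-, h⟩ := (mem_conjSub_L₁_iff g y).mp hy
  have h1 : IsConj (φ g.right y.left) (kill 3 (φ g.right y.left)) := by
    have h2 : IsConj (φ g.right y.left) (g.left * φ g.right y.left * g.left⁻¹) :=
      isConj_iff.mpr ⟨_, rfl⟩
    refine h2.trans ?_
    have h3 := (kill 3).map_isConj h2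
    rw [h] at h3
    exact h3.symm
  rw [kill_φ] at h1
  simpa using (φ g.right).symm.toMonoidHom.map_isConj h1

/-- Conjugates of `L₁` by elements in distinct cosets with equal image in `ℤ/4` meet trivially. -/
theorem eq_one_of_mem_of_right_eq {g g' y : G} (hy : y ∈ conjSub g L₁) (hy' : y ∈ conjSub g' L₁)
    (hr : g.right = g'.right) (hne : g' * g⁻¹ ∉ L₁) : y = 1 := by
  obtain ⟨h1, h2⟩ := (mem_conjSub_L₁_iff g y).mp hy
  obtain ⟨-, h3⟩ := (mem_conjSub_L₁_iff g' y).mp hy'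
  by_contra hy1
  have hl : y.left ≠ 1 := fun h => hy1 (SemidirectProduct.ext h h1)
  apply hne
  rw [mem_L₁_iff]
  have hl2 : (g' * g⁻¹).left = g'.left * g.left⁻¹ := by simp [hr]
  rw [hl2]
  refine ⟨by simp [hr], ?_⟩
  refine FreeGroup.fixed_of_conj_fixed (kill 3) (kill_kill 3)
    (h := g.left * φ g.right y.left * g.left⁻¹) (by simpa using hl) h2 ?_
  rw [← hr] at h3
  have h4 : g'.left * g.left⁻¹ * (g.left * φ g.right y.left * g.left⁻¹) *
      (g'.left * g.left⁻¹)⁻¹ = g'.left * φ g.right y.left * g'.left⁻¹ := by group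
  rw [h4, h3]

theorem eq_one_of_forall_isConj_kill {x : F} (h : ∀ j, IsConj x (kill j x)) : x = 1 := by
  have h1 := (h 0).trans ((kill 0).map_isConj ((h 1).trans ((kill 1).map_isConj
    ((h 2).trans ((kill 2).map_isConj (h 3))))))
  rw [kill_kill_kill_kill] at h1
  exact isConj_one_left.mp h1

theorem stmt18 :
    (∃ g : Fin 3 → G,
      (∀ i j, i ≠ j → g j * (g i)⁻¹ ∉ L₁) ∧
      Infinite ↥(⨅ i, conjSub (g i) L₁)) ∧
    (∀ g : Fin 4 → G,
      (∀ i j, i ≠ j → g j * (g i)⁻¹ ∉ L₁) →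
      Finite ↥(⨅ i, conjSub (g i) L₁)) := by
  constructor
  · refine ⟨fun i => SemidirectProduct.inr (Multiplicative.ofAdd ((i : ℕ) : ZMod 4)), ?_, ?_⟩
    · intro i j hij h
      have h1 := ((mem_L₁_iff _).mp h).1
      simp only [SemidirectProduct.mul_right, SemidirectProduct.inv_right,
        SemidirectProduct.right_inr] at h1
      clear h
      revert i j
      decide
    · have hmem : ∀ n : ℤ, (SemidirectProduct.inl (FreeGroup.of (0 : ZMod 4) ^ n) : G) ∈
          ⨅ i : Fin 3, conjSub
            (SemidirectProduct.inr (Multiplicative.ofAdd ((i : ℕ) : ZMod 4)) : G) L₁ := by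
        intro n
        rw [Subgroup.mem_iInf]
        intro i
        rw [mem_conjSub_L₁_iff]
        refine ⟨rfl, ?_⟩
        rw [SemidirectProduct.left_inl, SemidirectProduct.left_inr, SemidirectProduct.right_inr,
          one_mul, inv_one, mul_one, map_zpow, map_zpow, φ_of, kill_of,
          if_neg (by revert i; decide)]
      refine Infinite.of_injective (fun n : ℤ => ⟨_, hmem n⟩) fun m n hmn => ?_
      have h := SemidirectProduct.inl_injective (congrArg Subtype.val hmn)
      by_contra hne
      have h2 : (FreeGroup.of (0 : ZMod 4)) ^ (m - n) = 1 := by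
        rw [zpow_sub, h, mul_inv_cancel]
      rcases IsMulTorsionFree.zpow_eq_one_iff.mp h2 with h3 | h3
      · exact FreeGroup.of_ne_one _ h3
      · exact hne (sub_eq_zero.mp h3)
  · intro g hg
    suffices h : ∀ y ∈ ⨅ i, conjSub (g i) L₁, y = 1 by
      rw [(Subgroup.eq_bot_iff_forall _).mpr h]
      infer_instance
    intro y hy
    rw [Subgroup.mem_iInf] at hy
    by_cases hinj : Function.Injective fun i => (3 : ZMod 4) - (g i).right.toAdd
    · have hbij := (Fintype.bijective_iff_injective_and_card _).mpr ⟨hinj, by simp [ZMod.card]⟩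
      refine SemidirectProduct.ext (eq_one_of_forall_isConj_kill fun j => ?_)
        ((mem_conjSub_L₁_iff _ _).mp (hy 0)).1
      obtain ⟨i, rfl⟩ := hbij.2 j
      exact isConj_kill_of_mem (hy i)
    · rw [Function.Injective] at hinj
      push Not at hinj
      obtain ⟨i, j, hij, hne⟩ := hinj
      exact eq_one_of_mem_of_right_eq (hy i) (hy j)
        (Multiplicative.toAdd.injective (sub_right_injective hij)) (hg i j hne)
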